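/- Any finite partition of a convex body in ℝ² into convex pieces can be extended to a partition of the whole plane ℝ² into convex pieces, with each original piece contained in exactly one piece of the extended partition. -/

import Mathlib

open Set

noncomputable section

abbrev E2 := EuclideanSpace ℝ (Fin 2)

def IsConvexBody (C : Set E2) : Prop :=
  IsCompact C ∧ Convex ℝ C ∧ (interior C).Nonempty

/-- A second functional completing `f` to a coordinate system. -/
lemma exists_compl_functional (f : StrongDual ℝ E2) (hf : f ≠ 0) :
    ∃ g : StrongDual ℝ E2, ∀ x, f x = 0 → g x = 0 → x = 0 := by
  set p := f (EuclideanSpace.single 0 1) with hp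
  set q := f (EuclideanSpace.single 1 1) with hq
  have hfx : ∀ x : E2, f x = p * x 0 + q * x 1 := by
    intro x
    have : x = x 0 • EuclideanSpace.single (0 : Fin 2) (1 : ℝ)
        + x 1 • EuclideanSpace.single (1 : Fin 2) (1 : ℝ) := by
      ext i; fin_cases i <;> simp
    conv_lhs => rw [this]
    rw [map_add, map_smul, map_smul, ← hp, ← hq]
    simp [mul_comm]
  have hpq : 0 < p ^ 2 + q ^ 2 := by
    by_contra h
    have h1 : p = 0 := by nlinarith [sq_nonneg p, sq_nonneg q]
    have h2 : q = 0 := by nlinarith [sq_nonneg p, sq_nonneg q]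
    apply hf
    ext x
    simp [hfx, h1, h2]
  refine ⟨p • EuclideanSpace.proj (𝕜 := ℝ) (1 : Fin 2) - q • EuclideanSpace.proj (𝕜 := ℝ) (0 : Fin 2), ?_⟩
  intro x h1 h2
  rw [hfx] at h1
  simp at h2
  have h3 : (p ^ 2 + q ^ 2) * x 0 = 0 := by linear_combination p * h1 - q * h2
  have h4 : (p ^ 2 + q ^ 2) * x 1 = 0 := by linear_combination q * h1 + p * h2
  ext i
  fin_cases i
  · simpa [hpq.ne'] using h3
  · simpa [hpq.ne'] using h4

/-- Weak separation of closed convex sets with disjoint nonempty interiors. -/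
lemma sep_convex {A B : Set E2} (hA : Convex ℝ A) (hB : Convex ℝ B)
    (hAi : (interior A).Nonempty) (hBi : (interior B).Nonempty)
    (hd : interior A ∩ interior B = ∅) :
    ∃ (ψ : StrongDual ℝ E2) (u : ℝ), (∀ a ∈ A, ψ a ≤ u) ∧ (∀ b ∈ B, u ≤ ψ b) ∧
      (∀ a ∈ interior A, ψ a < u) ∧ (∀ b ∈ interior B, u < ψ b) := by
  obtain ⟨ψ, u, h1, h2⟩ := geometric_hahn_banach_open_open hA.interior isOpen_interior
    hB.interior isOpen_interior (disjoint_iff_inter_eq_empty.2 hd)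
  refine ⟨ψ, u, ?_, ?_, h1, h2⟩
  · intro a ha
    have : a ∈ closure (interior A) := by
      rw [hA.closure_interior_eq_closure_of_nonempty_interior hAi]; exact subset_closure ha
    exact closure_minimal (fun x hx => (h1 x hx).le)
      (isClosed_le ψ.continuous continuous_const) this
  · intro a ha
    have : a ∈ closure (interior B) := by
      rw [hB.closure_interior_eq_closure_of_nonempty_interior hBi]; exact subset_closure ha
    exact closure_minimal (fun x hx => (h2 x hx).le)
      (isClosed_le continuous_const ψ.continuous) this

/-- An open set inside a level set of a nonzero functional is empty. -/
lemma open_level_empty (f : StrongDual ℝ E2) (v : E2) (hv : f v ≠ 0) (c : ℝ) {U : Set E2}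
    (hU : IsOpen U) (h : ∀ x ∈ U, f x = c) : U = ∅ := by
  by_contra hne
  obtain ⟨x, hx⟩ := nonempty_iff_ne_empty.2 hne
  have hc : Continuous (fun t : ℝ => x + t • v) := by fun_prop
  have h1 : ∀ᶠ t in nhds (0 : ℝ), x + t • v ∈ U := by
    apply hc.continuousAt.eventually_mem
    apply hU.mem_nhds
    simpa using hx
  have h2 : ∀ᶠ t in nhdsWithin (0 : ℝ) {0}ᶜ, x + t • v ∈ U := h1.filter_mono nhdsWithin_le_nhds
  obtain ⟨t, ht, ht0⟩ := (h2.and self_mem_nhdsWithin).exists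
  have h3 := h _ ht
  rw [map_add, map_smul, h x hx, smul_eq_mul] at h3
  have : t * f v = 0 := by linarith
  rcases mul_eq_zero.1 this with h | h
  · exact ht0 h
  · exact hv h

/-- On a closed half plane, interior points satisfy the strict inequality. -/
lemma interior_lt (f : StrongDual ℝ E2) (v : E2) (hv : 0 < f v) (c : ℝ) {A : Set E2}
    (h : ∀ x ∈ A, f x ≤ c) : ∀ x ∈ interior A, f x < c := by
  intro x hx
  have hc : Continuous (fun t : ℝ => x + t • v) := by fun_prop
  have h1 : ∀ᶠ t in nhds (0 : ℝ), x + t • v ∈ interior A := by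
    apply hc.continuousAt.eventually_mem
    apply isOpen_interior.mem_nhds
    simpa using hx
  have h2 : ∀ᶠ t in nhdsWithin (0 : ℝ) (Ioi 0), x + t • v ∈ interior A :=
    h1.filter_mono nhdsWithin_le_nhds
  obtain ⟨t, ht, ht0⟩ := (h2.and self_mem_nhdsWithin).exists
  have h3 := h _ (interior_subset ht)
  rw [map_add, map_smul, smul_eq_mul] at h3
  have : 0 < t * f v := mul_pos ht0 hv
  linarith

/-- Betweenness on a line. -/
lemma mem_segment_of_between (f g : StrongDual ℝ E2) (hfg : ∀ x, f x = 0 → g x = 0 → x = 0)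
    {c : ℝ} {x y z : E2} (hx : f x = c) (hy : f y = c) (hz : f z = c)
    (h1 : g x ≤ g y) (h2 : g y ≤ g z) : y ∈ segment ℝ x z := by
  rcases eq_or_lt_of_le (h1.trans h2) with h | h
  · have : y - x = 0 := hfg _ (by simp [hx, hy]) (by rw [map_sub]; linarith)
    rw [sub_eq_zero.1 this]; exact left_mem_segment _ _ _
  · have hd : 0 < g z - g x := by linarith
    refine ⟨(g z - g y) / (g z - g x), (g y - g x) / (g z - g x), by
      apply div_nonneg <;> linarith, by apply div_nonneg <;> linarith, by field_simp; ring, ?_⟩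
    rw [← sub_eq_zero]
    apply hfg
    · simp only [map_sub, map_add, map_smul, smul_eq_mul, hx, hy, hz]; field_simp; ring
    · simp only [map_sub, map_add, map_smul, smul_eq_mul]; field_simp; ring

/-- Separating two pieces below a line that both touch the line. -/
lemma sep_line (f g : StrongDual ℝ E2) (hfg : ∀ x, f x = 0 → g x = 0 → x = 0)
    {c : ℝ} {A B : Set E2} (hA : Convex ℝ A) (hB : Convex ℝ B)
    (hAi : (interior A).Nonempty) (hBi : (interior B).Nonempty)
    (hd : interior A ∩ interior B = ∅) (v : E2) (hv : 0 < f v)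
    (hAf : ∀ x ∈ A, f x ≤ c) (hBf : ∀ x ∈ B, f x ≤ c)
    {s t : E2} (hs : s ∈ A) (ht : t ∈ B) (hsc : f s = c) (htc : f t = c) (hst : g s < g t) :
    ∃ (ψ : StrongDual ℝ E2) (u : ℝ), (∀ a ∈ A, ψ a ≤ u) ∧ (∀ b ∈ B, u ≤ ψ b) ∧
      (∀ x y, f x = f y → g x < g y → ψ x < ψ y) := by
  obtain ⟨ψ, u, h1, h2, h3, h4⟩ := sep_convex hA hB hAi hBi hd
  refine ⟨ψ, u, h1, h2, ?_⟩
  have key : ∀ w, f w = 0 → g (t - s) * ψ w = g w * ψ (t - s) := by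
    intro w hw
    have : g (t - s) • w - g w • (t - s) = 0 := by
      apply hfg
      · simp [hw, hsc, htc]
      · simp; ring
    have := congrArg ψ this
    simp only [map_sub, map_smul, smul_eq_mul, map_zero] at this ⊢
    linarith
  have hg : 0 < g (t - s) := by rw [map_sub]; linarith
  have hpos : 0 < ψ (t - s) := by
    have h0 : 0 ≤ ψ (t - s) := by rw [map_sub]; linarith [h1 s hs, h2 t ht]
    rcases eq_or_lt_of_le h0 with h | h
    · exfalso
      rw [map_sub] at h
      have hsu : ψ s = u := by linarith [h1 s hs, h2 t ht]
      obtain ⟨a, ha⟩ := hAi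
      obtain ⟨b, hb⟩ := hBi
      have fa := interior_lt f v hv c hAf a ha
      have fb := interior_lt f v hv c hBf b hb
      have pa := h3 a ha
      have pb := h4 b hb
      have := key (f (b - s) • (a - s) - f (a - s) • (b - s)) (by simp; ring)
      rw [map_sub ψ t s, ← h, mul_zero] at this
      have h5 := (mul_eq_zero.1 this).resolve_left hg.ne'
      simp only [map_sub, map_smul, smul_eq_mul] at h5
      rw [hsu, hsc] at h5
      nlinarith [mul_pos (sub_pos.2 fb) (sub_pos.2 pa), mul_pos (sub_pos.2 fa) (sub_pos.2 pb)]
    · exact h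
  intro x y hxy hgxy
  have := key (y - x) (by simp [hxy])
  have h6 : 0 < g (t - s) * ψ (y - x) := by
    rw [this]; apply mul_pos _ hpos; rw [map_sub]; linarith
  have := pos_of_mul_pos_right h6 hg.le
  rw [map_sub] at this; linarith

/-- Gluing two convex sets along a line. -/
lemma convex_glue (f : StrongDual ℝ E2) {c : ℝ} {A W : Set E2} (hA : Convex ℝ A) (hW : Convex ℝ W)
    (hAf : ∀ x ∈ A, f x ≤ c) (hWf : ∀ x ∈ W, c ≤ f x)
    (h : ∀ a ∈ A, ∀ b ∈ W, ∀ z ∈ segment ℝ a b, f z = c → z ∈ A ∧ z ∈ W) :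
    Convex ℝ (A ∪ W) := by
  have key : ∀ a ∈ A, ∀ b ∈ W, segment ℝ a b ⊆ A ∪ W := by
    intro a ha b hb
    have hcont : ContinuousOn f (segment ℝ a b) := f.continuous.continuousOn
    have hpre : IsPreconnected (segment ℝ a b) := (convex_segment a b).isPreconnected
    obtain ⟨z, hz, hzc⟩ := hpre.intermediate_value (left_mem_segment ℝ a b)
      (right_mem_segment ℝ a b) hcont ⟨hAf a ha, hWf b hb⟩
    obtain ⟨zA, zW⟩ := h a ha b hb z hz hzc
    intro y hy
    have : y ∈ segment ℝ a z ∪ segment ℝ z b := by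
      rw [segment_eq_image_lineMap] at hz hy
      obtain ⟨t, ht, rfl⟩ := hz
      obtain ⟨r, hr, rfl⟩ := hy
      rcases le_total r t with hrt | hrt
      · left
        have : AffineMap.lineMap a b r ∈ AffineMap.lineMap a b '' segment ℝ (0 : ℝ) t := by
          refine ⟨r, ?_, rfl⟩
          rw [segment_eq_Icc ht.1]; exact ⟨hr.1, hrt⟩
        rw [image_segment] at this
        simpa using this
      · right
        have : AffineMap.lineMap a b r ∈ AffineMap.lineMap a b '' segment ℝ t (1 : ℝ) := by
          refine ⟨r, ?_, rfl⟩
          rw [segment_eq_Icc ht.2]; exact ⟨hrt, hr.2⟩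
        rw [image_segment] at this
        simpa using this
    rcases this with h | h
    · exact Or.inl (hA.segment_subset ha zA h)
    · exact Or.inr (hW.segment_subset zW hb h)
  rw [convex_iff_segment_subset]
  rintro x (hx | hx) y (hy | hy)
  · exact (hA.segment_subset hx hy).trans subset_union_left
  · exact key x hx y hy
  · rw [segment_symm]; exact key y hy x hx
  · exact (hW.segment_subset hx hy).trans subset_union_right

theorem step {ι : Type} [Fintype ι] [Nonempty ι] (L : Set E2) (hLcl : IsClosed L)
    (hL : Convex ℝ L) (f : StrongDual ℝ E2) (c : ℝ) (P : ι → Set E2)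
    (hPc : ∀ i, IsClosed (P i)) (hP : ∀ i, Convex ℝ (P i))
    (hPi : ∀ i, (interior (P i)).Nonempty)
    (hcover : (⋃ i, P i) = L ∩ {x | f x ≤ c})
    (hdisj : ∀ i j, i ≠ j → interior (P i) ∩ interior (P j) = ∅) :
    ∃ Q : ι → Set E2, (∀ i, IsClosed (Q i)) ∧ (∀ i, Convex ℝ (Q i)) ∧ (∀ i, P i ⊆ Q i) ∧
      (⋃ i, Q i) = L ∧ (∀ i j, i ≠ j → interior (Q i) ∩ interior (Q j) = ∅) := by
  classical
  by_cases hLH : L ⊆ {x | f x ≤ c}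
  · exact ⟨P, hPc, hP, fun _ => Subset.rfl, by rw [hcover, inter_eq_left.2 hLH], hdisj⟩
  obtain ⟨b0, hb0, hb0c⟩ := not_subset.1 hLH
  have hb0c' : c < f b0 := not_le.1 hb0c
  have hPsub : ∀ i, ∀ x ∈ P i, x ∈ L ∧ f x ≤ c := by
    intro i x hx
    have : x ∈ ⋃ i, P i := mem_iUnion.2 ⟨i, hx⟩
    rw [hcover] at this; exact this
  obtain ⟨a0, ha0⟩ := hPi (Classical.arbitrary ι)
  have ha0' := hPsub _ _ (interior_subset ha0)
  have hv : 0 < f (b0 - a0) := by rw [map_sub]; linarith [ha0'.2]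
  have hf : f ≠ 0 := by
    rintro rfl; simp at hv
  obtain ⟨g, hfg⟩ := exists_compl_functional f hf
  -- minimal set of pieces covering the base
  obtain ⟨B, hB⟩ := exists_minimal_of_wellFoundedLT
    (fun B : Finset ι => ∀ x ∈ L, f x = c → ∃ i ∈ B, x ∈ P i) ⟨Finset.univ, by
      intro x hx hxc
      have : x ∈ ⋃ i, P i := by rw [hcover]; exact ⟨hx, hxc.le⟩
      simpa using this⟩
  have hBc := hB.prop
  have hS0 : ∀ j, ∃ s, j ∈ B → s ∈ L ∧ f s = c ∧ s ∈ P j ∧ ∀ k ∈ B, k ≠ j → s ∉ P k := by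
    intro j
    by_cases hj : j ∈ B
    · by_contra hcon
      push Not at hcon
      have : ∀ x ∈ L, f x = c → ∃ i ∈ B.erase j, x ∈ P i := by
        intro x hx hxc
        obtain ⟨i, hi, hxi⟩ := hBc x hx hxc
        by_cases hij : i = j
        · subst hij
          obtain ⟨_, h2⟩ := hcon x
          obtain ⟨k, hk, hki, hxk⟩ := h2 hx hxc hxi
          exact ⟨k, Finset.mem_erase.2 ⟨hki, hk⟩, hxk⟩
        · exact ⟨i, Finset.mem_erase.2 ⟨hij, hi⟩, hxi⟩
      have h3 := hB.le_of_le this (Finset.erase_subset j B) hj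
      simp at h3
    · exact ⟨0, fun h => absurd h hj⟩
  choose S hS using hS0
  have hinj : ∀ j ∈ B, ∀ x, f x = c → g x = g (S j) → x = S j := by
    intro j hj x hx hgx
    rw [← sub_eq_zero]
    apply hfg
    · rw [map_sub, hx, (hS j hj).2.1, sub_self]
    · rw [map_sub, hgx, sub_self]
  have hbet : ∀ j ∈ B, ∀ k ∈ B, k ≠ j → ∀ x ∈ P k, f x = c → ∀ y ∈ P k, f y = c →
      g x ≤ g (S j) → g (S j) ≤ g y → False := by
    intro j hj k hk hkj x hx hxc y hy hyc h1 h2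
    have := mem_segment_of_between f g hfg hxc (hS j hj).2.1 hyc h1 h2
    exact (hS j hj).2.2.2 k hk hkj ((hP k).segment_subset hx hy this)
  have hne : ∀ j ∈ B, ∀ k ∈ B, k ≠ j → g (S k) ≠ g (S j) := by
    intro j hj k hk hkj h
    exact hbet j hj k hk hkj _ (hS k hk).2.2.1 (hS k hk).2.1 _ (hS k hk).2.2.1 (hS k hk).2.1
      h.le h.ge
  -- separating functionals
  have hR0 : ∀ j, ∃ (ψ : StrongDual ℝ E2) (u : ℝ), j ∈ B → (∀ a ∈ P j, ψ a ≤ u) ∧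
      (∀ k ∈ B, g (S j) < g (S k) → (∀ l ∈ B, g (S j) < g (S l) → g (S k) ≤ g (S l)) →
        (∀ b ∈ P k, u ≤ ψ b) ∧ (∀ x y, f x = f y → g x < g y → ψ x < ψ y)) ∧
      ((∀ k ∈ B, ¬ g (S j) < g (S k)) → ∀ x, ψ x ≤ u) := by
    intro j
    by_cases hj : j ∈ B
    · by_cases hmax : ∃ k ∈ B, g (S j) < g (S k)
      · obtain ⟨k0, hk0, hjk0⟩ := hmax
        obtain ⟨k, hk, hkmin⟩ := Finset.exists_min_image (B.filter (fun k => g (S j) < g (S k)))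
          (fun k => g (S k)) ⟨k0, by simp [hk0, hjk0]⟩
        rw [Finset.mem_filter] at hk
        have hjk : j ≠ k := by rintro rfl; exact lt_irrefl _ hk.2
        obtain ⟨ψ, u, h1, h2, h3⟩ := sep_line f g hfg (hP j) (hP k) (hPi j) (hPi k)
          (hdisj j k hjk) _ hv (fun x hx => (hPsub j x hx).2) (fun x hx => (hPsub k x hx).2)
          (hS j hj).2.2.1 (hS k hk.1).2.2.1 (hS j hj).2.1 (hS k hk.1).2.1 hk.2
        refine ⟨ψ, u, fun _ => ⟨h1, ?_, fun h => absurd hjk0 (h k0 hk0)⟩⟩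
        intro l hl hjl hlmin
        have e1 := hlmin k hk.1 hk.2
        have e2 := hkmin l (by simp [hl, hjl])
        have : l = k := by
          by_contra hlk
          exact hne k hk.1 l hl hlk (le_antisymm e1 e2)
        subst this
        exact ⟨h2, h3⟩
      · refine ⟨0, 0, fun _ => ⟨fun _ _ => by simp, ?_, fun _ _ => by simp⟩⟩
        intro k hk hjk
        exact absurd ⟨k, hk, hjk⟩ hmax
    · exact ⟨0, 0, fun h => absurd h hj⟩
  choose ψ u hR using hR0
  have hnext : ∀ j ∈ B, ∀ k ∈ B, g (S j) < g (S k) → ∃ l ∈ B, g (S j) < g (S l) ∧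
      (∀ m ∈ B, g (S j) < g (S m) → g (S l) ≤ g (S m)) := by
    intro j hj k0 hk0 hjk0
    obtain ⟨k, hk, hkmin⟩ := Finset.exists_min_image (B.filter (fun k => g (S j) < g (S k)))
      (fun k => g (S k)) ⟨k0, by simp [hk0, hjk0]⟩
    rw [Finset.mem_filter] at hk
    exact ⟨k, hk.1, hk.2, fun m hm hjm => hkmin m (by simp [hm, hjm])⟩
  have hmono : ∀ j ∈ B, ∀ k ∈ B, g (S j) < g (S k) →
      ∀ x y, f x = f y → g x < g y → ψ j x < ψ j y := by
    intro j hj k hk hjk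
    obtain ⟨l, hl, hjl, hmin⟩ := hnext j hj k hk hjk
    exact ((hR j hj).2.1 l hl hjl hmin).2
  have hright : ∀ j ∈ B, ∀ k ∈ B, g (S j) < g (S k) → ∀ x ∈ P k, f x = c → u j ≤ ψ j x := by
    intro j hj k hk hjk x hx hxc
    obtain ⟨l, hl, hjl, hmin⟩ := hnext j hj k hk hjk
    obtain ⟨h1, h2⟩ := (hR j hj).2.1 l hl hjl hmin
    by_cases hlk : k = l
    · subst hlk; exact h1 x hx
    have hxl : g (S l) < g x := by
      by_contra hcon
      exact hbet l hl k hk hlk x hx hxc (S k) (hS k hk).2.2.1 (hS k hk).2.1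
        (not_lt.1 hcon) (hmin k hk hjk)
    have := h2 (S l) x (by rw [hxc, (hS l hl).2.1]) hxl
    linarith [h1 (S l) (hS l hl).2.2.1]
  have hI : ∀ j ∈ B, ∀ x ∈ L, f x = c → ψ j x ≤ u j →
      (∀ i ∈ B, g (S i) < g (S j) → (∀ m ∈ B, g (S i) < g (S m) → g (S j) ≤ g (S m)) →
        u i ≤ ψ i x) → x ∈ P j := by
    intro j hj x hx hxc hxr hxl
    obtain ⟨sL, sc, sP, -⟩ := hS j hj
    suffices h : openSegment ℝ (S j) x ⊆ P j by
      have h2 := closure_minimal h (hPc j)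
      exact h2 (segment_subset_closure_openSegment (right_mem_segment ℝ (S j) x))
    intro y hy
    have hyL : y ∈ L := hL.openSegment_subset sL hx hy
    obtain ⟨p, q, hp, hq, hpq, rfl⟩ := hy
    set y := p • S j + q • x with hydef
    have hyc : f y = c := by
      simp only [hydef, map_add, map_smul, smul_eq_mul, hxc, sc]
      rw [← add_mul, hpq, one_mul]
    have hgy : g y = p * g (S j) + q * g x := by simp [hydef]
    have hpe : p = 1 - q := by linarith
    have hgy1 : g y - g (S j) = q * (g x - g (S j)) := by rw [hgy, hpe]; ring
    have hgy2 : g x - g y = p * (g x - g (S j)) := by rw [hgy, hpe]; ring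
    obtain ⟨k, hk, hyk⟩ := hBc y hyL hyc
    by_cases hkj : k = j
    · subst hkj; exact hyk
    exfalso
    obtain ⟨kL, kc, kP, -⟩ := hS k hk
    rcases lt_trichotomy (g x) (g (S j)) with hlt | heq | hgt
    · have h1 : g y < g (S j) := by nlinarith
      have h2 : g x < g y := by nlinarith
      rcases lt_or_gt_of_ne (hne j hj k hk hkj) with hkl | hkl
      · -- there is a predecessor
        obtain ⟨i, hi, himax⟩ := Finset.exists_max_image
          (B.filter (fun k => g (S k) < g (S j))) (fun k => g (S k)) ⟨k, by simp [hk, hkl]⟩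
        rw [Finset.mem_filter] at hi
        have hprev : ∀ m ∈ B, g (S i) < g (S m) → g (S j) ≤ g (S m) := by
          intro m hm him
          by_contra hcon
          have := himax m (by simp [hm, not_le.1 hcon])
          linarith
        have hx' := hxl i hi.1 hi.2 hprev
        have hmi := hmono i hi.1 j hj hi.2
        have hyi : u i < ψ i y := lt_of_le_of_lt hx' (hmi x y (by rw [hxc, hyc]) h2)
        by_cases hki : k = i
        · subst hki
          linarith [(hR k hk).1 y hyk]
        · have hSi := (hR i hi.1).1 (S i) (hS i hi.1).2.2.1
          apply hbet i hi.1 k hk hki (S k) kP kc y hyk hyc (himax k (by simp [hk, hkl]))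
          by_contra hcon
          have := hmi y (S i) (by rw [hyc, (hS i hi.1).2.1]) (not_le.1 hcon)
          linarith
      · exact hbet j hj k hk hkj y hyk hyc (S k) kP kc h1.le hkl.le
    · apply (hS j hj).2.2.2 k hk hkj
      have : y = S j := hinj j hj y hyc (by rw [heq] at hgy1; linarith)
      rw [← this]; exact hyk
    · have h1 : g (S j) < g y := by nlinarith
      have h2 : g y < g x := by nlinarith
      rcases lt_or_gt_of_ne (hne j hj k hk hkj) with hkl | hkl
      · exact hbet j hj k hk hkj (S k) kP kc y hyk hyc hkl.le h1.le
      · have := hmono j hj k hk hkl y x (by rw [hxc, hyc]) h2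
        linarith [hright j hj k hk hkl y hyk hyc]
  -- the new parts
  let W : ι → Set E2 := fun j => {x | j ∈ B ∧ x ∈ L ∧ c ≤ f x ∧ ψ j x ≤ u j ∧
    ∀ i ∈ B, g (S i) < g (S j) → u i ≤ ψ i x}
  have hWcl : ∀ j, IsClosed (W j) := by
    intro j
    refine isClosed_const.inter (hLcl.inter ((isClosed_le continuous_const f.continuous).inter
      ((isClosed_le (ψ j).continuous continuous_const).inter ?_)))
    have : {x : E2 | ∀ i ∈ B, g (S i) < g (S j) → u i ≤ ψ i x} =
        ⋂ i, ⋂ (_ : i ∈ B), ⋂ (_ : g (S i) < g (S j)), {x | u i ≤ ψ i x} := by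
      ext x; simp
    change IsClosed {x : E2 | ∀ i ∈ B, g (S i) < g (S j) → u i ≤ ψ i x}
    rw [this]
    exact isClosed_iInter fun i => isClosed_iInter fun _ => isClosed_iInter fun _ =>
      isClosed_le continuous_const (ψ i).continuous
  have hWconv : ∀ j, Convex ℝ (W j) := by
    rintro j x ⟨hj, hx1, hx2, hx3, hx4⟩ y ⟨-, hy1, hy2, hy3, hy4⟩ p q hp hq hpq
    refine ⟨hj, hL hx1 hy1 hp hq hpq, convex_halfSpace_ge f.isLinear c hx2 hy2 hp hq hpq,
      convex_halfSpace_le (ψ j).isLinear (u j) hx3 hy3 hp hq hpq, ?_⟩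
    intro i hi hij
    exact convex_halfSpace_ge (ψ i).isLinear (u i) (hx4 i hi hij) (hy4 i hi hij) hp hq hpq
  refine ⟨fun j => P j ∪ W j, fun j => (hPc j).union (hWcl j), ?_, fun j => subset_union_left,
    ?_, ?_⟩
  · intro j
    apply convex_glue f (hP j) (hWconv j) (fun x hx => (hPsub j x hx).2) (fun x hx => hx.2.2.1)
    rintro a ha b ⟨hj, hb1, hb2, hb3, hb4⟩ z hz hzc
    have hzL : z ∈ L := hL.segment_subset (hPsub j a ha).1 hb1 hz
    have hzr : ψ j z ≤ u j := by
      have hc : Convex ℝ {x | ψ j x ≤ u j} := convex_halfSpace_le (ψ j).isLinear _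
      exact hc.segment_subset ((hR j hj).1 a ha) hb3 hz
    have hzP : z ∈ P j := by
      apply hI j hj z hzL hzc hzr
      intro i hi hij hmin
      have hc : Convex ℝ {x | u i ≤ ψ i x} := convex_halfSpace_ge (ψ i).isLinear _
      exact hc.segment_subset (((hR i hi).2.1 j hj hij hmin).1 a ha) (hb4 i hi hij) hz
    exact ⟨hzP, hj, hzL, hzc.ge, hzr, fun i hi hij => hright i hi j hj hij z hzP hzc⟩
  · apply Subset.antisymm
    · apply iUnion_subset
      rintro j x (hx | hx)
      · exact (hPsub j x hx).1
      · exact hx.2.1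
    · intro x hx
      rcases le_or_gt (f x) c with hxc | hxc
      · have : x ∈ ⋃ i, P i := by rw [hcover]; exact ⟨hx, hxc⟩
        obtain ⟨i, hi⟩ := mem_iUnion.1 this
        exact mem_iUnion.2 ⟨i, Or.inl hi⟩
      · -- B is nonempty
        have hpre : IsPreconnected (segment ℝ a0 b0) := (convex_segment a0 b0).isPreconnected
        obtain ⟨z, hz, hzc⟩ := hpre.intermediate_value (left_mem_segment ℝ a0 b0)
          (right_mem_segment ℝ a0 b0) f.continuous.continuousOn ⟨ha0'.2, hb0c'.le⟩
        obtain ⟨i0, hi0, -⟩ := hBc z (hL.segment_subset ha0'.1 hb0 hz) hzc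
        obtain ⟨mx, hmx, hmxm⟩ := Finset.exists_max_image B (fun k => g (S k)) ⟨i0, hi0⟩
        obtain ⟨j, hj, hjm⟩ := Finset.exists_min_image (B.filter (fun k => ψ k x ≤ u k))
          (fun k => g (S k)) ⟨mx, by
            rw [Finset.mem_filter]
            exact ⟨hmx, (hR mx hmx).2.2 (fun k hk => not_lt.2 (hmxm k hk)) x⟩⟩
        rw [Finset.mem_filter] at hj
        refine mem_iUnion.2 ⟨j, Or.inr ⟨hj.1, hx, hxc.le, hj.2, ?_⟩⟩
        intro i hi hij
        by_contra hcon
        have := hjm i (by rw [Finset.mem_filter]; exact ⟨hi, (not_le.1 hcon).le⟩)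
        linarith
  · have main : ∀ i j, i ≠ j → (i ∈ B → j ∈ B → g (S i) < g (S j)) →
        interior (P i ∪ W i) ∩ interior (P j ∪ W j) = ∅ := by
      intro i j hij hlt
      have hUo : IsOpen (interior (P i ∪ W i) ∩ interior (P j ∪ W j)) :=
        isOpen_interior.inter isOpen_interior
      set U := interior (P i ∪ W i) ∩ interior (P j ∪ W j) with hU
      have hU1 : ∀ x ∈ U, x ∈ P i ∪ W i := fun x hx => interior_subset hx.1
      have hU2 : ∀ x ∈ U, x ∈ P j ∪ W j := fun x hx => interior_subset hx.2
      apply open_level_empty f _ hv.ne' c hUo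
      intro x hx
      rcases lt_trichotomy (f x) c with h | h | h
      · exfalso
        have hV : IsOpen (U ∩ {x | f x < c}) := hUo.inter (isOpen_lt f.continuous continuous_const)
        have hVi : U ∩ {x | f x < c} ⊆ interior (P i) := by
          apply interior_maximal _ hV
          rintro y ⟨hy, hyc⟩
          rcases hU1 y hy with h | h
          · exact h
          · exact absurd hyc (not_lt.2 h.2.2.1)
        have hVj : U ∩ {x | f x < c} ⊆ interior (P j) := by
          apply interior_maximal _ hV
          rintro y ⟨hy, hyc⟩
          rcases hU2 y hy with h | h
          · exact h
          · exact absurd hyc (not_lt.2 h.2.2.1)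
        have : x ∈ interior (P i) ∩ interior (P j) := ⟨hVi ⟨hx, h⟩, hVj ⟨hx, h⟩⟩
        rw [hdisj i j hij] at this
        exact this
      · exact h
      · exfalso
        have hV : IsOpen (U ∩ {x | c < f x}) := hUo.inter (isOpen_lt continuous_const f.continuous)
        have hVi : ∀ y ∈ U ∩ {x | c < f x}, y ∈ W i := by
          rintro y ⟨hy, hyc⟩
          rcases hU1 y hy with h | h
          · exact absurd hyc (not_lt.2 (hPsub i y h).2)
          · exact h
        have hVj : ∀ y ∈ U ∩ {x | c < f x}, y ∈ W j := by
          rintro y ⟨hy, hyc⟩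
          rcases hU2 y hy with h | h
          · exact absurd hyc (not_lt.2 (hPsub j y h).2)
          · exact h
        have hi : i ∈ B := (hVi x ⟨hx, h⟩).1
        have hj : j ∈ B := (hVj x ⟨hx, h⟩).1
        have hl := hlt hi hj
        have hpos := hmono i hi j hj hl (S i) (S j) (by rw [(hS i hi).2.1, (hS j hj).2.1]) hl
        have hne' : ψ i (S j - S i) ≠ 0 := by rw [map_sub]; linarith
        have hemp := open_level_empty (ψ i) _ hne' (u i) hV (fun y hy =>
          le_antisymm (hVi y hy).2.2.2.1 ((hVj y hy).2.2.2.2 i hi hl))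
        have : x ∈ U ∩ {x | c < f x} := ⟨hx, h⟩
        rw [hemp] at this
        exact this
    intro i j hij
    by_cases hlt : i ∈ B → j ∈ B → g (S i) < g (S j)
    · exact main i j hij hlt
    · rw [inter_comm]
      apply main j i hij.symm
      intro hj hi
      push Not at hlt
      exact lt_of_le_of_ne hlt.2.2 (hne i hi j hj hij.symm)

/-- Partitions of finite intersections of half planes extend to the plane. -/
theorem extend_polygon {ι : Type} [Fintype ι] [Nonempty ι] {α : Type} (f : α → StrongDual ℝ E2)
    (c : α → ℝ) (T : Finset α) : ∀ (P : ι → Set E2)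
    (_ : ∀ i, IsClosed (P i)) (_ : ∀ i, Convex ℝ (P i))
    (_ : ∀ i, (interior (P i)).Nonempty)
    (_ : (⋃ i, P i) = {x | ∀ t ∈ T, f t x ≤ c t})
    (_ : ∀ i j, i ≠ j → interior (P i) ∩ interior (P j) = ∅),
    ∃ Q : ι → Set E2, (∀ i, IsClosed (Q i)) ∧ (∀ i, Convex ℝ (Q i)) ∧ (∀ i, P i ⊆ Q i) ∧
      (⋃ i, Q i) = univ ∧ (∀ i j, i ≠ j → interior (Q i) ∩ interior (Q j) = ∅) := by
  classical
  induction T using Finset.induction_on with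
  | empty =>
    intro P h1 h2 h3 h4 h5
    exact ⟨P, h1, h2, fun _ => Subset.rfl, by rw [h4]; simp, h5⟩
  | insert a T ha ih =>
    intro P h1 h2 h3 h4 h5
    have hL : {x : E2 | ∀ t ∈ T, f t x ≤ c t} = ⋂ t ∈ T, {x | f t x ≤ c t} := by
      ext x; simp
    obtain ⟨Q, q1, q2, q3, q4, q5⟩ := step {x | ∀ t ∈ T, f t x ≤ c t}
      (by rw [hL]; exact isClosed_biInter fun t _ => isClosed_le (f t).continuous continuous_const)
      (by rw [hL]; exact convex_iInter₂ fun t _ => convex_halfSpace_le (f t).isLinear _)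
      (f a) (c a) P h1 h2 h3 (by rw [h4]; ext x; simp [and_comm]) h5
    obtain ⟨R, r1, r2, r3, r4, r5⟩ := ih Q q1 q2
      (fun i => (h3 i).mono (interior_mono (q3 i))) q4 q5
    exact ⟨R, r1, r2, fun i => (q3 i).trans (r3 i), r4, r5⟩

/-- A polygon between a compact convex set and a convex body. -/
lemma exists_polygon {K A : Set E2} (hK : IsCompact K) (hA : Convex ℝ A) (hAc : IsClosed A)
    (hAK : A ⊆ interior K) (hAne : A.Nonempty) :
    ∃ (f : E2 → StrongDual ℝ E2) (c : E2 → ℝ) (T : Finset E2),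
      A ⊆ {x | ∀ t ∈ T, f t x ≤ c t} ∧ {x | ∀ t ∈ T, f t x ≤ c t} ⊆ K := by
  have h0 : ∀ x, ∃ (f : StrongDual ℝ E2) (c : ℝ), x ∈ frontier K →
      (∀ a ∈ A, f a < c) ∧ c < f x := by
    intro x
    by_cases hx : x ∈ frontier K
    · have : x ∉ A := fun h => hx.2 (hAK h)
      obtain ⟨f, c, h⟩ := geometric_hahn_banach_closed_point hA hAc this
      exact ⟨f, c, fun _ => h⟩
    · exact ⟨0, 0, fun h => absurd h hx⟩
  choose f c hfc using h0
  have hfr : IsCompact (frontier K) := hK.of_isClosed_subset isClosed_frontier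
    (frontier_subset_iff_isClosed.2 hK.isClosed)
  obtain ⟨T, hT, hcov⟩ := hfr.elim_nhds_subcover (fun x => {y | c x < f x y}) (fun x hx =>
    (isOpen_lt continuous_const (f x).continuous).mem_nhds (hfc x hx).2)
  refine ⟨f, c, T, fun a ha t ht => ((hfc t (hT t ht)).1 a ha).le, ?_⟩
  intro y hy
  by_contra hyK
  obtain ⟨a, ha⟩ := hAne
  have hpre : IsPreconnected (segment ℝ a y) := (convex_segment a y).isPreconnected
  have hsub : segment ℝ a y ⊆ interior K ∪ Kᶜ := by
    intro z hz
    by_contra hcon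
    rw [mem_union, not_or, notMem_compl_iff] at hcon
    have hzf : z ∈ frontier K := ⟨subset_closure hcon.2, hcon.1⟩
    obtain ⟨t, ht, hzt⟩ := mem_iUnion₂.1 (hcov hzf)
    have hc : Convex ℝ {x | f t x ≤ c t} := convex_halfSpace_le (f t).isLinear _
    have := hc.segment_subset ((hfc t (hT t ht)).1 a ha).le (hy t ht) hz
    have hzt' : c t < f t z := hzt
    have this' : f t z ≤ c t := this
    linarith
  have := hpre.subset_left_of_subset_union isOpen_interior hK.isClosed.isOpen_compl
    (disjoint_compl_right.mono_left interior_subset) hsub ⟨a, left_mem_segment ℝ a y, hAK ha⟩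
    (right_mem_segment ℝ a y)
  exact hyK (interior_subset this)

/-- Ultrafilter limits of partitions of the plane. -/
theorem limit_partition {ι α : Type} [Fintype ι] (U : Ultrafilter α) (Q : α → ι → Set E2)
    (h1 : ∀ᶠ n in U, ∀ i, Convex ℝ (Q n i))
    (h2 : ∀ᶠ n in U, ∀ i, (interior (Q n i)).Nonempty)
    (h3 : ∀ᶠ n in U, (⋃ i, Q n i) = univ)
    (h4 : ∀ᶠ n in U, ∀ i j, i ≠ j → interior (Q n i) ∩ interior (Q n j) = ∅) :
    ∃ R : ι → Set E2, (∀ i, IsClosed (R i)) ∧ (∀ i, Convex ℝ (R i)) ∧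
      (∀ i x, (∀ᶠ n in U, x ∈ Q n i) → x ∈ R i) ∧
      (⋃ i, R i) = univ ∧ (∀ i j, i ≠ j → interior (R i) ∩ interior (R j) = ∅) := by
  let R : ι → Set E2 := fun i => {x | ∀ ε > 0, ∀ᶠ n in U, x ∈ Metric.thickening ε (Q n i)}
  have hcl : ∀ i, IsClosed (R i) := by
    intro i
    apply isClosed_of_closure_subset
    intro x hx ε hε
    obtain ⟨y, hy, hxy⟩ := Metric.mem_closure_iff.1 hx (ε / 2) (by linarith)
    filter_upwards [hy (ε / 2) (by linarith)] with n hn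
    rw [Metric.mem_thickening_iff] at hn ⊢
    obtain ⟨z, hz, hyz⟩ := hn
    exact ⟨z, hz, by linarith [dist_triangle x y z]⟩
  refine ⟨R, hcl, ?_, ?_, ?_, ?_⟩
  · intro i x hx y hy p q hp hq hpq ε hε
    filter_upwards [hx ε hε, hy ε hε, h1] with n hxn hyn hn
    exact (hn i).thickening ε hxn hyn hp hq hpq
  · intro i x hx ε hε
    filter_upwards [hx] with n hn
    exact Metric.self_subset_thickening hε _ hn
  · rw [eq_univ_iff_forall]
    intro x
    by_contra hcon
    simp only [mem_iUnion, not_exists] at hcon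
    have h5 : ∀ i, ∀ᶠ n in U, x ∉ Q n i := by
      intro i
      have := hcon i
      simp only [R, mem_ofPred_eq, not_forall] at this
      obtain ⟨ε, hε, h⟩ := this
      rw [← Ultrafilter.eventually_not] at h
      filter_upwards [h] with n hn hx
      exact hn (Metric.self_subset_thickening hε _ hx)
    have h6 : ∀ᶠ n in U, ∀ i, x ∉ Q n i := Filter.eventually_all.2 h5
    obtain ⟨n, hn, hn'⟩ := (h6.and h3).exists
    have : x ∈ ⋃ i, Q n i := by rw [hn']; trivial
    obtain ⟨i, hi⟩ := mem_iUnion.1 this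
    exact hn i hi
  · intro i j hij
    by_contra hne
    obtain ⟨x, hx⟩ := nonempty_iff_ne_empty.2 hne
    obtain ⟨δ, hδ, hball⟩ := Metric.nhds_basis_closedBall.mem_iff.1
      ((isOpen_interior.inter isOpen_interior).mem_nhds hx)
    have hcompact : IsCompact (Metric.closedBall x δ) := isCompact_closedBall x δ
    -- uniform approximation on the ball
    have happ : ∀ k, Metric.closedBall x δ ⊆ R k →
        ∀ᶠ n in U, Metric.closedBall x δ ⊆ Metric.thickening (δ / 2) (Q n k) := by
      intro k hk
      obtain ⟨t, ht, hcov⟩ := hcompact.elim_nhds_subcover (fun y => Metric.ball y (δ / 4))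
        (fun y _ => Metric.ball_mem_nhds y (by linarith))
      have : ∀ᶠ n in U, ∀ y ∈ t, y ∈ Metric.thickening (δ / 4) (Q n k) := by
        rw [Filter.eventually_all_finset]
        intro y hy
        exact hk (ht y hy) (δ / 4) (by linarith)
      filter_upwards [this] with n hn z hz
      obtain ⟨y, hy, hzy⟩ := mem_iUnion₂.1 (hcov hz)
      have := hn y hy
      rw [Metric.mem_thickening_iff] at this ⊢
      obtain ⟨w, hw, hyw⟩ := this
      have hzy' : dist z y < δ / 4 := hzy
      exact ⟨w, hw, by linarith [dist_triangle z y w]⟩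
    have hi := happ i (fun y hy => interior_subset (hball hy).1)
    have hj := happ j (fun y hy => interior_subset (hball hy).2)
    obtain ⟨n, hin, hjn, c1, c2, c4⟩ :=
      (hi.and (hj.and (h1.and (h2.and h4)))).exists
    obtain ⟨ψ, u, s1, s2, s3, s4⟩ := sep_convex (c1 i) (c1 j) (c2 i) (c2 j) (c4 i j hij)
    set w := (InnerProductSpace.toDual ℝ E2).symm ψ with hw
    have hψ : ∀ y, ψ y = inner ℝ w y := by
      intro y
      rw [hw, InnerProductSpace.toDual_symm_apply]
    have hw0 : w ≠ 0 := by
      intro h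
      obtain ⟨a, ha⟩ := c2 i
      obtain ⟨b, hb⟩ := c2 j
      have e1 := s3 a ha
      have e2 := s4 b hb
      rw [hψ, h, inner_zero_left] at e1 e2
      linarith
    have hwn : 0 < ‖w‖ := norm_pos_iff.2 hw0
    have hnorm : ∀ y, ψ y ≤ ‖w‖ * ‖y‖ := fun y => by rw [hψ]; exact real_inner_le_norm w y
    have hψw : ψ ((δ / ‖w‖) • w) = δ * ‖w‖ := by
      rw [map_smul, hψ, real_inner_self_eq_norm_sq, smul_eq_mul]; field_simp
    have hnw : ‖(δ / ‖w‖) • w‖ = δ := by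
      rw [norm_smul, Real.norm_of_nonneg (by positivity)]; field_simp
    have m1 : x + (δ / ‖w‖) • w ∈ Metric.closedBall x δ := by
      rw [Metric.mem_closedBall, dist_eq_norm]; simp only [add_sub_cancel_left]; exact hnw.le
    have m2 : x - (δ / ‖w‖) • w ∈ Metric.closedBall x δ := by
      rw [Metric.mem_closedBall, dist_eq_norm, sub_sub_cancel_left, norm_neg]; exact hnw.le
    obtain ⟨y1, hy1, d1⟩ := Metric.mem_thickening_iff.1 (hin m1)
    obtain ⟨y2, hy2, d2⟩ := Metric.mem_thickening_iff.1 (hjn m2)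
    rw [dist_eq_norm] at d1
    rw [dist_comm, dist_eq_norm] at d2
    have n1 := hnorm (x + (δ / ‖w‖) • w - y1)
    have n2 := hnorm (y2 - (x - (δ / ‖w‖) • w))
    have e1 := s1 y1 hy1
    have e2 := s2 y2 hy2
    simp only [map_sub, map_add, hψw] at n1 n2
    have l1 := mul_lt_mul_of_pos_left d1 hwn
    have l2 := mul_lt_mul_of_pos_left d2 hwn
    nlinarith

/-- The extension theorem for nondegenerate pieces. -/
theorem extend_nondeg {ι : Type} [Fintype ι] [Nonempty ι] (K : Set E2) (hK : IsCompact K)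
    (hKc : Convex ℝ K) (P : ι → Set E2)
    (hPc : ∀ i, IsClosed (P i)) (hP : ∀ i, Convex ℝ (P i))
    (hPi : ∀ i, (interior (P i)).Nonempty)
    (hcover : (⋃ i, P i) = K)
    (hdisj : ∀ i j, i ≠ j → interior (P i) ∩ interior (P j) = ∅) :
    ∃ Q : ι → Set E2, (∀ i, IsClosed (Q i)) ∧ (∀ i, Convex ℝ (Q i)) ∧ (∀ i, P i ⊆ Q i) ∧
      (⋃ i, Q i) = univ ∧ (∀ i j, i ≠ j → interior (Q i) ∩ interior (Q j) = ∅) := by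
  classical
  have hPK : ∀ i, P i ⊆ K := fun i => hcover ▸ subset_iUnion P i
  choose z hz using hPi
  have hzK : ∀ i, z i ∈ interior K := fun i => interior_mono (hPK i) (hz i)
  have hpoly : ∀ F : Finset (interior K), ∃ (f : E2 → StrongDual ℝ E2) (c : E2 → ℝ)
      (T : Finset E2), (∀ x ∈ F, (x : E2) ∈ interior {x | ∀ t ∈ T, f t x ≤ c t}) ∧
        {x | ∀ t ∈ T, f t x ≤ c t} ⊆ K := by
    intro F
    set F' : Set E2 := insert (z (Classical.arbitrary ι)) ((fun x : interior K => (x : E2)) '' F)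
      with hF'
    have hfin : F'.Finite := (F.finite_toSet.image _).insert _
    have hsub : F' ⊆ interior K := by
      rintro x (rfl | ⟨y, -, rfl⟩)
      · exact hzK _
      · exact y.2
    obtain ⟨u, hu1, hu2⟩ := (convex_convexHull ℝ F').exists_subset_interior_convexHull_finset_of_isCompact
      (hfin.isCompact_convexHull ℝ)
      (isOpen_interior.mem_nhdsSet.2 (convexHull_min hsub hKc.interior))
    have hu3 : F' ⊆ interior (convexHull ℝ (u : Set E2)) := (subset_convexHull ℝ F').trans hu1
    obtain ⟨f, c, T, h1, h2⟩ := exists_polygon hK (convex_convexHull ℝ (u : Set E2))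
      (u.finite_toSet.isCompact_convexHull ℝ).isClosed hu2
      ⟨_, interior_subset (hu3 (mem_insert _ _))⟩
    exact ⟨f, c, T, fun x hx => interior_mono h1 (hu3 (mem_insert_of_mem _ ⟨x, hx, rfl⟩)), h2⟩
  choose f c T hT1 hT2 using hpoly
  have hQ : ∀ F : Finset (interior K), ∃ Q : ι → Set E2,
      (∀ i, (⟨z i, hzK i⟩ : interior K) ∈ F) →
      (∀ i, Convex ℝ (Q i)) ∧ (∀ i, (interior (Q i)).Nonempty) ∧
      (∀ i, P i ∩ {x | ∀ t ∈ T F, f F t x ≤ c F t} ⊆ Q i) ∧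
      (⋃ i, Q i) = univ ∧ (∀ i j, i ≠ j → interior (Q i) ∩ interior (Q j) = ∅) := by
    intro F
    by_cases hF : ∀ i, (⟨z i, hzK i⟩ : interior K) ∈ F
    · set KF := {x | ∀ t ∈ T F, f F t x ≤ c F t} with hKF
      have hKF' : KF = ⋂ t ∈ T F, {x | f F t x ≤ c F t} := by
        ext x; simp [hKF]
      have hKFcl : IsClosed KF := by
        rw [hKF']
        exact isClosed_biInter fun t _ => isClosed_le (f F t).continuous continuous_const
      have hKFc : Convex ℝ KF := by
        rw [hKF']
        exact convex_iInter₂ fun t _ => convex_halfSpace_le (f F t).isLinear _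
      have hint : ∀ i, (interior (P i ∩ KF)).Nonempty := by
        intro i
        rw [interior_inter]
        exact ⟨z i, hz i, hT1 F _ (hF i)⟩
      obtain ⟨Q, q1, q2, q3, q4, q5⟩ := extend_polygon (f F) (c F) (T F) (fun i => P i ∩ KF)
        (fun i => (hPc i).inter hKFcl) (fun i => (hP i).inter hKFc) hint
        (by rw [← iUnion_inter, hcover]; exact inter_eq_right.2 (hT2 F))
        (fun i j hij => by
          apply subset_empty_iff.1
          rw [← hdisj i j hij]
          exact inter_subset_inter (interior_mono inter_subset_left)
            (interior_mono inter_subset_left))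
      exact ⟨Q, fun _ => ⟨q2, fun i => (hint i).mono (interior_mono (q3 i)), q3, q4, q5⟩⟩
    · exact ⟨fun _ => ∅, fun h => absurd h hF⟩
  choose Q hQ using hQ
  let U : Ultrafilter (Finset (interior K)) := Ultrafilter.of Filter.atTop
  have hmem : ∀ x : interior K, ∀ᶠ F : Finset (interior K) in U, x ∈ F := by
    intro x
    have : ∀ᶠ F : Finset (interior K) in Filter.atTop, x ∈ F := by
      filter_upwards [Filter.eventually_ge_atTop {x}] with F hF
      exact hF (Finset.mem_singleton_self x)
    exact Ultrafilter.of_le Filter.atTop this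
  have hev : ∀ᶠ F : Finset (interior K) in U, ∀ i, (⟨z i, hzK i⟩ : interior K) ∈ F :=
    Filter.eventually_all.2 fun i => hmem _
  obtain ⟨R, r1, r2, r3, r4, r5⟩ := limit_partition U Q
    (hev.mono fun F hF => (hQ F hF).1) (hev.mono fun F hF => (hQ F hF).2.1)
    (hev.mono fun F hF => (hQ F hF).2.2.2.1) (hev.mono fun F hF => (hQ F hF).2.2.2.2)
  refine ⟨R, r1, r2, ?_, r4, r5⟩
  intro i
  have h1 : interior (P i) ⊆ R i := by
    intro x hx
    apply r3
    filter_upwards [hev, hmem ⟨x, interior_mono (hPK i) hx⟩] with F hF hxF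
    exact (hQ F hF).2.2.1 i ⟨interior_subset hx, interior_subset (hT1 F _ hxF)⟩
  have h2 := closure_minimal h1 (r1 i)
  rw [(hP i).closure_interior_eq_closure_of_nonempty_interior ⟨z i, hz i⟩] at h2
  exact subset_closure.trans h2

theorem partition_extension (K : Set E2) (hK : IsConvexBody K)
    (m : ℕ) (P : Fin m → Set E2)
    (hP : ∀ i, IsClosed (P i) ∧ Convex ℝ (P i))
    (hcover : (⋃ i, P i) = K)
    (hdisj : ∀ i j, i ≠ j → interior (P i) ∩ interior (P j) = ∅) :
    ∃ Q : Fin m → Set E2,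
      (∀ i, IsClosed (Q i) ∧ Convex ℝ (Q i)) ∧
      (⋃ i, Q i) = Set.univ ∧
      (∀ i j, i ≠ j → interior (Q i) ∩ interior (Q j) = ∅) ∧
      (∀ i, Q i ∩ K = P i) := by
  classical
  obtain ⟨hKcomp, hKc, hKi⟩ := hK
  have hPK : ∀ i, P i ⊆ K := fun i => hcover ▸ subset_iUnion P i
  let N := {i : Fin m // (interior (P i)).Nonempty}
  have hcl : IsClosed (⋃ i : N, P i) := isClosed_iUnion_of_finite fun i => (hP i).1
  have hNK : (⋃ i : N, P i) = K := by
    apply Subset.antisymm (iUnion_subset fun i : N => hPK i.1)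
    have hdense : Dense (⋂ i : {i : Fin m // ¬ (interior (P i)).Nonempty}, (P i)ᶜ) := by
      apply dense_iInter_of_isOpen
      · exact fun i => (hP i).1.isOpen_compl
      · intro i
        exact interior_eq_empty_iff_dense_compl.1 (not_nonempty_iff_eq_empty.1 i.2)
    have h1 : interior K ⊆ closure (⋃ i : N, P i) := by
      refine (hdense.open_subset_closure_inter isOpen_interior).trans (closure_mono ?_)
      rintro x ⟨hx, hx2⟩
      have : x ∈ ⋃ i, P i := by rw [hcover]; exact interior_subset hx
      obtain ⟨i, hi⟩ := mem_iUnion.1 this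
      by_cases hd : (interior (P i)).Nonempty
      · exact mem_iUnion.2 ⟨⟨i, hd⟩, hi⟩
      · exact absurd hi (mem_iInter.1 hx2 ⟨i, hd⟩)
    rw [hcl.closure_eq] at h1
    have h2 := closure_minimal h1 hcl
    rw [hKc.closure_interior_eq_closure_of_nonempty_interior hKi] at h2
    exact subset_closure.trans h2
  have : Nonempty N := by
    obtain ⟨x, hx⟩ := hKi
    have : x ∈ ⋃ i : N, P i := by rw [hNK]; exact interior_subset hx
    obtain ⟨i, -⟩ := mem_iUnion.1 this
    exact ⟨i⟩
  obtain ⟨Q, q1, q2, q3, q4, q5⟩ := extend_nondeg (ι := N) K hKcomp hKc (fun i => P i)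
    (fun i => (hP i).1) (fun i => (hP i).2) (fun i => i.2) hNK
    (fun i j hij => hdisj i j (fun h => hij (Subtype.ext h)))
  have q6 : ∀ i : N, Q i ∩ K = P i := by
    intro i
    apply Subset.antisymm _ (subset_inter (q3 i) (hPK i))
    have hne : (interior (Q i ∩ K)).Nonempty :=
      i.2.mono (interior_mono (subset_inter (q3 i) (hPK i)))
    have h1 : interior (Q i ∩ K) ⊆ P i := by
      intro y hy
      by_contra hyP
      have hV : IsOpen (interior (Q i ∩ K) ∩ (P i)ᶜ) :=
        isOpen_interior.inter (hP i).1.isOpen_compl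
      have hyK : y ∈ ⋃ i : N, P i := by rw [hNK]; exact (interior_subset hy).2
      obtain ⟨j, hj⟩ := mem_iUnion.1 hyK
      have hij : i ≠ j := by rintro rfl; exact hyP hj
      have hyc : y ∈ closure (interior (P j)) := by
        rw [(hP j).2.closure_interior_eq_closure_of_nonempty_interior j.2]
        exact subset_closure hj
      obtain ⟨w, ⟨hw1, -⟩, hw2⟩ := mem_closure_iff.1 hyc _ hV ⟨hy, hyP⟩
      have : w ∈ interior (Q i) ∩ interior (Q j) :=
        ⟨interior_mono inter_subset_left hw1, interior_mono (q3 j) hw2⟩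
      rw [q5 i j hij] at this
      exact this
    have h2 := closure_minimal h1 (hP i).1
    rw [((q2 i).inter hKc).closure_interior_eq_closure_of_nonempty_interior hne] at h2
    exact subset_closure.trans h2
  refine ⟨fun i => if h : (interior (P i)).Nonempty then Q ⟨i, h⟩ else P i, ?_, ?_, ?_, ?_⟩
  · intro i
    by_cases h : (interior (P i)).Nonempty
    · simp only [dif_pos h]; exact ⟨q1 _, q2 _⟩
    · simp only [dif_neg h]; exact hP i
  · rw [eq_univ_iff_forall]
    intro x
    have : x ∈ ⋃ i, Q i := by rw [q4]; trivial
    obtain ⟨i, hi⟩ := mem_iUnion.1 this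
    refine mem_iUnion.2 ⟨i, ?_⟩
    simp only [dif_pos i.2]
    exact hi
  · intro i j hij
    by_cases hi : (interior (P i)).Nonempty
    · by_cases hj : (interior (P j)).Nonempty
      · simp only [dif_pos hi, dif_pos hj]
        exact q5 _ _ (fun h => hij (congrArg Subtype.val h))
      · simp only [dif_neg hj]
        rw [not_nonempty_iff_eq_empty.1 hj, inter_empty]
    · simp only [dif_neg hi]
      rw [not_nonempty_iff_eq_empty.1 hi, empty_inter]
  · intro i
    by_cases h : (interior (P i)).Nonempty
    · simp only [dif_pos h]; exact q6 ⟨i, h⟩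
    · simp only [dif_neg h]; exact inter_eq_left.2 (hPK i)

end
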